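/- (Conditional-variance term of Claim 4) With F̂(S) the k-DISCount estimator based on n i.i.d. samples from ḡ_Ω and r = 1 − p(S), the law-of-total-variance terms evaluate to E[Var(F̂(S) | n(S))] = G(S)² · σ²(S) · (1 − r^n) · E[1/n(S) | n(S) > 0] and Var(E[F̂(S) | n(S)]) = F(S)² · r^n · (1 − r^n). -/

import Mathlib

open Finset Filter

noncomputable section

variable {Ω : Type*} [Fintype Ω] [DecidableEq Ω]

/-- Expectation of `X : (Fin n → Ω) → ℝ` under `n` i.i.d. samples drawn from the
pmf `q` on the finite type `Ω` (the `n`-fold product measure). -/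
noncomputable def iidExp (n : ℕ) (q : Ω → ℝ) (X : (Fin n → Ω) → ℝ) : ℝ :=
  ∑ v : Fin n → Ω, (∏ i, q (v i)) * X v

/-- Probability of the event `P` under `n` i.i.d. samples drawn from the pmf `q`. -/
noncomputable def iidPr (n : ℕ) (q : Ω → ℝ) (P : (Fin n → Ω) → Prop) [DecidablePred P] : ℝ :=
  iidExp n q fun v => if P v then 1 else 0

/-- Variance of `X` under `n` i.i.d. samples drawn from the pmf `q`. -/
noncomputable def iidVar (n : ℕ) (q : Ω → ℝ) (X : (Fin n → Ω) → ℝ) : ℝ :=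
  iidExp n q fun v => (X v - iidExp n q X) ^ 2

/-- `n(S)`: the number of the samples `v 0, …, v (n-1)` that land in `S`. -/
def nIn (S : Finset Ω) {n : ℕ} (v : Fin n → Ω) : ℕ :=
  (Finset.univ.filter fun i => v i ∈ S).card

/-- The `k`-DISCount estimator `F̂(S)`: equal to
`G(S) · (1/n(S)) · ∑_{i : sᵢ ∈ S} f(sᵢ)/g(sᵢ)` if `n(S) > 0`, and `0` otherwise. -/
noncomputable def kdis (S : Finset Ω) (f g : Ω → ℝ) {n : ℕ} (v : Fin n → Ω) : ℝ :=
  if 0 < nIn S v then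
    (∑ s ∈ S, g s) *
      ((nIn S v : ℝ)⁻¹ * ∑ i ∈ Finset.univ.filter (fun i => v i ∈ S), f (v i) / g (v i))
  else 0

/-- Conditional expectation of `X` given the event `{n(S) = m}`, under `n`
i.i.d. samples from the pmf `q`. -/
noncomputable def condExpN (n : ℕ) (q : Ω → ℝ) (S : Finset Ω)
    (X : (Fin n → Ω) → ℝ) (m : ℕ) : ℝ :=
  iidExp n q (fun v => X v * if nIn S v = m then 1 else 0) /
    iidPr n q (fun v => nIn S v = m)

/-- Conditional variance of `X` given the event `{n(S) = m}`. -/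
noncomputable def condVarN (n : ℕ) (q : Ω → ℝ) (S : Finset Ω)
    (X : (Fin n → Ω) → ℝ) (m : ℕ) : ℝ :=
  condExpN n q S (fun v => (X v - condExpN n q S X m) ^ 2) m

set_option linter.unusedSectionVars false

section IidExpectation

variable (n : ℕ) (q : Ω → ℝ)

theorem iidExp_add (X Y : (Fin n → Ω) → ℝ) :
    iidExp n q (fun v => X v + Y v) = iidExp n q X + iidExp n q Y := by
  simp only [iidExp, mul_add, Finset.sum_add_distrib]

theorem iidExp_const_mul (c : ℝ) (X : (Fin n → Ω) → ℝ) :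
    iidExp n q (fun v => c * X v) = c * iidExp n q X := by
  simp only [iidExp, Finset.mul_sum]
  exact Finset.sum_congr rfl fun v _ => by ring

theorem iidExp_sum {ι : Type*} (s : Finset ι) (X : ι → (Fin n → Ω) → ℝ) :
    iidExp n q (fun v => ∑ i ∈ s, X i v) = ∑ i ∈ s, iidExp n q (X i) := by
  simp only [iidExp, Finset.mul_sum]
  exact Finset.sum_comm

variable {n q}

theorem iidExp_mono (hq : ∀ s, 0 ≤ q s) {X Y : (Fin n → Ω) → ℝ} (h : ∀ v, X v ≤ Y v) :
    iidExp n q X ≤ iidExp n q Y :=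
  Finset.sum_le_sum fun v _ =>
    mul_le_mul_of_nonneg_left (h v) (Finset.prod_nonneg fun i _ => hq (v i))

theorem iidExp_prod (a : Ω → ℝ) :
    iidExp n q (fun v => ∏ i, a (v i)) = (∑ s, q s * a s) ^ n := by
  simp only [iidExp, ← Finset.prod_mul_distrib]
  rw [Fintype.sum_pow]

theorem iidPr_pos (hq : ∀ s, 0 < q s) {P : (Fin n → Ω) → Prop} [DecidablePred P]
    {v : Fin n → Ω} (hv : P v) : 0 < iidPr n q P := by
  refine Finset.sum_pos' (fun w _ => mul_nonneg (Finset.prod_nonneg fun i _ => (hq _).le) ?_)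
    ⟨v, Finset.mem_univ v, ?_⟩
  · dsimp only
    split_ifs <;> norm_num
  · simpa [hv] using Finset.prod_pos fun i _ => hq (v i)

/-- Resampling one coordinate inside `S`: if `Ψ` only sees whether the `i`-th sample lies in `S`,
a factor `a` of that sample, supported on `S`, may be replaced by any `b` of equal mean. -/
theorem iidExp_congr_coord {S : Finset Ω} {a b : Ω → ℝ}
    (ha : ∀ s ∉ S, a s = 0) (hb : ∀ s ∉ S, b s = 0) (hab : ∑ s, q s * a s = ∑ s, q s * b s)
    (i : Fin n) {Ψ : (Fin n → Ω) → ℝ}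
    (hΨ : ∀ v, ∀ s ∈ S, ∀ t ∈ S, Ψ (Function.update v i s) = Ψ (Function.update v i t)) :
    iidExp n q (fun v => a (v i) * Ψ v) = iidExp n q (fun v => b (v i) * Ψ v) := by
  obtain _ | m := n
  · exact i.elim0
  have key : ∀ c : Ω → ℝ, iidExp (m + 1) q (fun v => c (v i) * Ψ v) =
      ∑ w : Fin m → Ω, (∏ j, q (w j)) *
        ∑ s, q s * c s * Ψ (i.insertNth (α := fun _ => Ω) s w) := by
    intro c
    rw [iidExp, ← (Fin.insertNthEquiv (fun _ => Ω) i).sum_comp, Fintype.sum_prod_type,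
      Finset.sum_comm]
    refine Finset.sum_congr rfl fun w _ => ?_
    rw [Finset.mul_sum]
    refine Finset.sum_congr rfl fun s _ => ?_
    change (∏ j, q (i.insertNth (α := fun _ => Ω) s w j)) *
      (c (i.insertNth (α := fun _ => Ω) s w i) * Ψ (i.insertNth (α := fun _ => Ω) s w)) = _
    simp only [Fin.prod_univ_succAbove _ i, Fin.insertNth_apply_same,
      Fin.insertNth_apply_succAbove]
    ring
  rw [key, key]
  refine Finset.sum_congr rfl fun w _ => ?_
  congr 1
  obtain rfl | ⟨t, ht⟩ := S.eq_empty_or_nonempty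
  · simp [funext fun s => ha s (Finset.notMem_empty s), funext fun s => hb s (Finset.notMem_empty s)]
  have const : ∀ c : Ω → ℝ, (∀ s ∉ S, c s = 0) →
      ∑ s, q s * c s * Ψ (i.insertNth (α := fun _ => Ω) s w) =
        (∑ s, q s * c s) * Ψ (i.insertNth (α := fun _ => Ω) t w) := by
    intro c hc
    rw [Finset.sum_mul]
    refine Finset.sum_congr rfl fun s _ => ?_
    by_cases hs : s ∈ S
    · have := hΨ (i.insertNth (α := fun _ => Ω) t w) s hs t ht
      rw [Fin.update_insertNth, Fin.update_insertNth] at this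
      rw [this]
    · simp [hc s hs]
  rw [const a ha, const b hb, hab]

end IidExpectation

section Counting

variable {n : ℕ} {S : Finset Ω}

theorem nIn_update (v : Fin n → Ω) (i : Fin n) {s t : Ω} (hs : s ∈ S) (ht : t ∈ S) :
    nIn S (Function.update v i s) = nIn S (Function.update v i t) := by
  unfold nIn
  congr 1
  ext j
  obtain rfl | hj := eq_or_ne j i
  · simp [hs, ht]
  · simp [hj]

theorem cast_nIn (v : Fin n → Ω) : (nIn S v : ℝ) = ∑ i, if v i ∈ S then 1 else 0 := by
  simp [nIn]

theorem nIn_eq_zero_iff (v : Fin n → Ω) : nIn S v = 0 ↔ ∀ i, v i ∉ S := by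
  simp [nIn, Finset.filter_eq_empty_iff]

theorem iidExp_one {q : Ω → ℝ} (hq : ∑ s, q s = 1) : iidExp n q (fun _ => 1) = 1 := by
  simpa [hq] using iidExp_prod (n := n) (q := q) fun _ => 1

theorem iidPr_nIn_pos {q : Ω → ℝ} (hq : ∑ s, q s = 1) :
    iidPr n q (fun v => 0 < nIn S v) = 1 - (1 - ∑ s ∈ S, q s) ^ n := by
  have h0 : ∑ s, q s * (if s ∈ S then 0 else 1) = 1 - ∑ s ∈ S, q s := by
    rw [eq_sub_iff_add_eq]
    refine Eq.trans ?_ hq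
    rw [← Finset.sum_filter_add_sum_filter_not univ (· ∈ S) q]
    simp [Finset.sum_ite, add_comm]
  rw [← h0, ← iidExp_prod, eq_sub_iff_add_eq, iidPr, ← iidExp_add]
  refine Eq.trans ?_ (iidExp_one (n := n) hq)
  congr 1
  ext v
  by_cases h : nIn S v = 0
  · have h' := (nIn_eq_zero_iff v).1 h
    simp [h, h']
  · have h' := (nIn_eq_zero_iff v).not.1 h
    push Not at h'
    obtain ⟨i, hi⟩ := h'
    rw [Finset.prod_eq_zero (Finset.mem_univ i) (by simp [hi])]
    simp [Nat.pos_of_ne_zero h]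

theorem iidExp_sum_mul_nIn {q h : Ω → ℝ} (hh : ∀ s ∉ S, h s = 0) (h_mean : ∑ s, q s * h s = 0)
    (φ : ℕ → ℝ) : iidExp n q (fun v => (∑ i, h (v i)) * φ (nIn S v)) = 0 := by
  simp only [Finset.sum_mul]
  rw [iidExp_sum]
  refine Finset.sum_eq_zero fun i _ => ?_
  rw [iidExp_congr_coord (b := fun _ => 0) hh (by simp) (by simp [h_mean]) i
    (fun v s hs t ht => by rw [nIn_update v i hs ht])]
  simp [iidExp]

theorem iidExp_sum_sq_mul_nIn {q h : Ω → ℝ} {τ : ℝ} (hh : ∀ s ∉ S, h s = 0)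
    (h_mean : ∑ s, q s * h s = 0) (h_var : ∑ s, q s * h s ^ 2 = τ * ∑ s ∈ S, q s) (φ : ℕ → ℝ) :
    iidExp n q (fun v => (∑ i, h (v i)) ^ 2 * φ (nIn S v)) =
      τ * iidExp n q (fun v => nIn S v * φ (nIn S v)) := by
  simp only [cast_nIn, sq, Finset.sum_mul_sum]
  simp only [Finset.sum_mul]
  rw [iidExp_sum, iidExp_sum, Finset.mul_sum]
  refine Finset.sum_congr rfl fun i _ => ?_
  rw [iidExp_sum, Finset.sum_eq_single i, ← iidExp_const_mul]
  · simp only [← mul_assoc]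
    refine iidExp_congr_coord (S := S) (a := fun s => h s * h s)
      (b := fun s => τ * if s ∈ S then 1 else 0) (fun s hs => by simp [hh s hs])
      (fun s hs => by simp [hs]) ?_ i (fun v s hs t ht => by rw [nIn_update v i hs ht])
    simp only [← sq, h_var, Finset.mul_sum]
    simp [mul_comm]
  · intro j _ hj
    simp only [mul_assoc]
    rw [iidExp_congr_coord (b := fun _ => 0) hh (by simp) (by simp [h_mean]) i
      (Ψ := fun v => h (v j) * φ (nIn S v))
      (fun v s hs t ht => by simp only [nIn_update v i hs ht, Function.update_of_ne hj])]
    simp [iidExp]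
  · simp

theorem iidPr_mul_iidExp_inv_nIn_div {q : Ω → ℝ} (hq : ∀ s, 0 ≤ q s) :
    iidPr n q (fun v => 0 < nIn S v) *
        (iidExp n q (fun v => (nIn S v : ℝ)⁻¹ * if 0 < nIn S v then 1 else 0) /
          iidPr n q (fun v => 0 < nIn S v)) =
      iidExp n q (fun v => (nIn S v : ℝ)⁻¹) := by
  have hinv : iidExp n q (fun v => (nIn S v : ℝ)⁻¹ * if 0 < nIn S v then 1 else 0) =
      iidExp n q (fun v => (nIn S v : ℝ)⁻¹) := by
    congr 1
    ext v
    obtain hv | hv := Nat.eq_zero_or_pos (nIn S v) <;> simp [hv]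
  rw [hinv]
  refine mul_div_cancel_of_imp' fun h0 => le_antisymm ?_ ?_
  · rw [← h0]
    refine iidExp_mono hq fun v => ?_
    split_ifs with hv
    · exact inv_le_one_of_one_le₀ (by exact_mod_cast hv)
    · simp [Nat.eq_zero_of_not_pos hv]
  · exact Finset.sum_nonneg fun v _ =>
      mul_nonneg (Finset.prod_nonneg fun i _ => hq _) (by positivity)

end Counting

section Conditional

variable {n : ℕ} {S : Finset Ω} {q f g h : Ω → ℝ} {F G τ : ℝ}

theorem condExpN_eq_of_decomp (hh : ∀ s ∉ S, h s = 0) (h_mean : ∑ s, q s * h s = 0)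
    {X : (Fin n → Ω) → ℝ}
    (hX : ∀ v, X v = F * (if 0 < nIn S v then 1 else 0) + G * (nIn S v : ℝ)⁻¹ * ∑ i, h (v i))
    {m : ℕ} (hm : iidPr n q (fun v => nIn S v = m) ≠ 0) :
    condExpN n q S X m = F * if 0 < m then 1 else 0 := by
  rw [condExpN, div_eq_iff hm, iidPr, ← iidExp_const_mul]
  have key := iidExp_sum_mul_nIn (n := n) hh h_mean
    fun k => G * (m : ℝ)⁻¹ * if k = m then 1 else 0
  refine Eq.trans ?_ ((congrArg _ key).trans (add_zero _))
  rw [← iidExp_add]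
  congr 1
  ext v
  by_cases hv : nIn S v = m
  · simp only [hX v, hv, if_true]
    ring
  · simp [hv]

theorem condVarN_eq_of_decomp (hh : ∀ s ∉ S, h s = 0) (h_mean : ∑ s, q s * h s = 0)
    (h_var : ∑ s, q s * h s ^ 2 = τ * ∑ s ∈ S, q s) {X : (Fin n → Ω) → ℝ}
    (hX : ∀ v, X v = F * (if 0 < nIn S v then 1 else 0) + G * (nIn S v : ℝ)⁻¹ * ∑ i, h (v i))
    {m : ℕ} (hm : iidPr n q (fun v => nIn S v = m) ≠ 0) :
    condVarN n q S X m = G ^ 2 * τ * (m : ℝ)⁻¹ := by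
  rw [condVarN, condExpN_eq_of_decomp hh h_mean hX hm, condExpN, div_eq_iff hm]
  have key := iidExp_sum_sq_mul_nIn (n := n) hh h_mean h_var
    fun k => (G * (m : ℝ)⁻¹) ^ 2 * if k = m then 1 else 0
  calc _ = _ := ?_
    _ = _ := key
    _ = _ := ?_
  · congr 1
    ext v
    by_cases hv : nIn S v = m
    · simp only [hX v, hv, if_true]
      ring
    · simp [hv]
  · rw [iidPr, ← iidExp_const_mul, ← iidExp_const_mul]
    congr 1
    ext v
    by_cases hv : nIn S v = m
    · simp only [hv, if_true]
      obtain rfl | hm0 := eq_or_ne m 0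
      · simp
      · field_simp
    · simp [hv]

/-- The ratio `f / g` on `S`, centred at `F(S) / G(S)` and extended by zero off `S`. -/
def centeredRatio (S : Finset Ω) (f g : Ω → ℝ) (s : Ω) : ℝ :=
  if s ∈ S then f s / g s - (∑ t ∈ S, f t) / ∑ t ∈ S, g t else 0

theorem kdis_eq_centered (hG : ∑ s ∈ S, g s ≠ 0) (v : Fin n → Ω) :
    kdis S f g v = (∑ s ∈ S, f s) * (if 0 < nIn S v then 1 else 0) +
      (∑ s ∈ S, g s) * (nIn S v : ℝ)⁻¹ *
        ∑ i, centeredRatio S f g (v i) := by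
  unfold kdis centeredRatio
  rw [← Finset.sum_filter, Finset.sum_sub_distrib, Finset.sum_const, ← nIn, nsmul_eq_mul]
  split_ifs with h
  · have : (nIn S v : ℝ) ≠ 0 := by positivity
    field_simp
    ring
  · simp [Nat.eq_zero_of_not_pos h]

theorem sum_mul_centeredRatio (hg : ∀ s, g s ≠ 0) (hG : ∑ s ∈ S, g s ≠ 0) (c : ℝ) :
    ∑ s, g s / c * centeredRatio S f g s = 0 := by
  have h1 : ∀ s ∈ S, g s / c * (f s / g s - (∑ t ∈ S, f t) / ∑ t ∈ S, g t) =
      (f s - g s * ((∑ t ∈ S, f t) / ∑ t ∈ S, g t)) / c := by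
    intro s _
    rw [div_mul_eq_mul_div, mul_sub, mul_div_cancel₀ _ (hg s)]
  simp only [centeredRatio, mul_ite, mul_zero, Finset.sum_ite_mem, Finset.univ_inter]
  rw [Finset.sum_congr rfl h1, ← Finset.sum_div, Finset.sum_sub_distrib, ← Finset.sum_mul,
    mul_div_cancel₀ _ hG, sub_self, zero_div]

theorem sum_mul_centeredRatio_sq (hG : ∑ s ∈ S, g s ≠ 0) (c : ℝ) :
    ∑ s, g s / c * centeredRatio S f g s ^ 2 =
      (∑ s ∈ S, (g s / ∑ t ∈ S, g t) * (f s / g s - (∑ t ∈ S, f t) / ∑ t ∈ S, g t) ^ 2) *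
        ∑ s ∈ S, g s / c := by
  simp only [centeredRatio, ite_pow, mul_ite, ne_eq, OfNat.ofNat_ne_zero, not_false_eq_true,
    zero_pow, mul_zero, Finset.sum_ite_mem, Finset.univ_inter]
  rw [← Finset.sum_div, Finset.sum_mul]
  refine Finset.sum_congr rfl fun s _ => ?_
  rw [div_mul_eq_mul_div, div_mul_eq_mul_div, div_mul_div_comm, mul_comm _ c,
    mul_div_mul_right _ _ hG]

end Conditional

/-- **Law-of-total-variance terms of Claim 4.**
With `F̂(S)` the k-DISCount estimator based on `n` i.i.d. samples from `ḡ_Ω` and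
`r = 1 − p(S)`:
`E[Var(F̂(S) | n(S))] = G(S)² σ²(S) (1 − rⁿ) E[1/n(S) | n(S) > 0]` and
`Var(E[F̂(S) | n(S)]) = F(S)² rⁿ (1 − rⁿ)`. -/
theorem kdiscount_total_variance_terms
    (S : Finset Ω) (hS : S.Nonempty) (f g : Ω → ℝ)
    (hf : ∀ s, 0 ≤ f s) (hg : ∀ s, 0 < g s)
    (n : ℕ) (q : Ω → ℝ) (hq : q = fun s => g s / ∑ t, g t)
    (r : ℝ) (hr : r = 1 - (∑ s ∈ S, g s) / ∑ s, g s)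
    (σ2 : ℝ)
    (hσ2 : σ2 = ∑ s ∈ S, (g s / ∑ t ∈ S, g t) *
        (f s / g s - (∑ t ∈ S, f t) / ∑ t ∈ S, g t) ^ 2) :
    (iidExp n q (fun v => condVarN n q S (fun w => kdis S f g w) (nIn S v))
        = (∑ s ∈ S, g s) ^ 2 * σ2 * (1 - r ^ n) *
            (iidExp n q (fun v => ((nIn S v : ℝ))⁻¹ * if 0 < nIn S v then 1 else 0) /
              iidPr n q (fun v => 0 < nIn S v))) ∧
    (iidVar n q (fun v => condExpN n q S (fun w => kdis S f g w) (nIn S v))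
        = (∑ s ∈ S, f s) ^ 2 * r ^ n * (1 - r ^ n)) := by
  have hGS_pos : 0 < ∑ s ∈ S, g s := Finset.sum_pos (fun s _ => hg s) hS
  have hGΩ_pos : 0 < ∑ t, g t :=
    Finset.sum_pos (fun s _ => hg s) (hS.mono (Finset.subset_univ S))
  have hq_pos : ∀ s, 0 < q s := fun s => by rw [hq]; exact div_pos (hg s) hGΩ_pos
  have hq_sum : ∑ s, q s = 1 := by
    rw [hq, ← Finset.sum_div, div_self hGΩ_pos.ne']
  have hq_S : ∑ s ∈ S, q s = (∑ s ∈ S, g s) / ∑ t, g t := by rw [hq, ← Finset.sum_div]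
  have hh : ∀ s ∉ S, centeredRatio S f g s = 0 := fun s hs => if_neg hs
  have h_mean : ∑ s, q s * centeredRatio S f g s = 0 := by
    rw [hq]
    exact sum_mul_centeredRatio (fun s => (hg s).ne') hGS_pos.ne' _
  have h_var : ∑ s, q s * centeredRatio S f g s ^ 2 = σ2 * ∑ s ∈ S, q s := by
    rw [hq, hσ2]
    exact sum_mul_centeredRatio_sq hGS_pos.ne' _
  have hX := kdis_eq_centered (n := n) (f := f) hGS_pos.ne'
  have hPr : ∀ v : Fin n → Ω, iidPr n q (fun w => nIn S w = nIn S v) ≠ 0 :=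
    fun v => (iidPr_pos (P := fun w => nIn S w = nIn S v) (v := v) hq_pos rfl).ne'
  have hpos : iidPr n q (fun v => 0 < nIn S v) = 1 - r ^ n := by
    rw [iidPr_nIn_pos hq_sum, hq_S, hr]
  have hE : iidExp n q (fun v => if 0 < nIn S v then 1 else 0) = 1 - r ^ n := hpos
  refine ⟨?_, ?_⟩
  · simp only [condVarN_eq_of_decomp hh h_mean h_var hX (hPr _)]
    rw [iidExp_const_mul, mul_assoc _ (1 - r ^ n), ← hpos]
    rw [iidPr_mul_iidExp_inv_nIn_div fun s => (hq_pos s).le]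
  · simp only [condExpN_eq_of_decomp hh h_mean hX (hPr _), iidVar]
    rw [iidExp_const_mul, hE]
    have hsq : ∀ v : Fin n → Ω,
        ((∑ s ∈ S, f s) * (if 0 < nIn S v then 1 else 0) - (∑ s ∈ S, f s) * (1 - r ^ n)) ^ 2 =
          (∑ s ∈ S, f s) ^ 2 * (2 * r ^ n - 1) * (if 0 < nIn S v then 1 else 0) +
            (∑ s ∈ S, f s) ^ 2 * (1 - r ^ n) ^ 2 * 1 := by
      intro v
      split_ifs <;> ring
    simp only [hsq]
    rw [iidExp_add, iidExp_const_mul, iidExp_const_mul, hE, iidExp_one hq_sum]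
    ring
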